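/- Fix N ≥ 2, A = {1,…,N}, the full shift X = A^ℤ, and k distinct one-sided sequences x_1,…,x_k ∈ A^ℕ whose length-n prefixes w_{1,n},…,w_{k,n} are pairwise distinct for every n ≥ 1; let K_n = {w_{1,n},…,w_{k,n}}. Assume the matrix α(N) is invertible (this holds in particular whenever k < N). Then the limit λ(x_1,…,x_k) := lim_{n→∞} (h(X) − h(X_{K_n}))/N^{−n} exists and equals T/N, where T is the sum of the entries of α(N)^{−1}. -/

import Mathlib

open Filter Topology

section SubshiftBasics

variable {A : Type*}

/-- The left shift map on bi-infinite sequences. -/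
def shiftZ (x : ℤ → A) : ℤ → A := fun i => x (i + 1)

/-- The word `w` occurs (as a subword) in the bi-infinite sequence `x`. -/
def occursIn (w : List A) (x : ℤ → A) : Prop :=
  ∃ i : ℤ, ∀ k : Fin w.length, x (i + (k : ℕ)) = w.get k

/-- A subshift: a closed, shift-invariant subset of `A^ℤ` (prodiscrete topology). -/
def IsSubshift [TopologicalSpace A] (X : Set (ℤ → A)) : Prop :=
  IsClosed X ∧ ∀ x ∈ X, shiftZ x ∈ X

/-- The language of `X`: all finite words occurring in points of `X`. -/
def language (X : Set (ℤ → A)) : Set (List A) :=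
  { w | ∃ x ∈ X, occursIn w x }

/-- The words of length `n` in the language of `X`. -/
def langN (X : Set (ℤ → A)) (n : ℕ) : Set (List A) :=
  { w | w ∈ language X ∧ w.length = n }

/-- Topological entropy of a subshift, `lim (1/n) log #L_n(X)` (as a limsup,
which agrees with the limit when the latter exists). -/
noncomputable def entropy (X : Set (ℤ → A)) : ℝ :=
  Filter.limsup (fun n : ℕ => Real.log ((langN X n).ncard) / n) Filter.atTop

/-- The perturbation `X_w`: points of `X` not containing `w` as a subword. -/
def perturb (X : Set (ℤ → A)) (w : List A) : Set (ℤ → A) :=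
  { x ∈ X | ¬ occursIn w x }

/-- Multi-word perturbation `X_K`. -/
def perturbFamily (X : Set (ℤ → A)) (K : Set (List A)) : Set (ℤ → A) :=
  { x ∈ X | ∀ w ∈ K, ¬ occursIn w x }

/-- Irreducibility of a subshift. -/
def IrreducibleSubshift (X : Set (ℤ → A)) : Prop :=
  ∀ u ∈ language X, ∀ w ∈ language X, ∃ v, u ++ v ++ w ∈ language X

/-- `m` is a synchronizing word for `X`. -/
def IsSynchronizingWord (X : Set (ℤ → A)) (m : List A) : Prop :=
  m ∈ language X ∧
    ∀ u v : List A, u ++ m ∈ language X → m ++ v ∈ language X → u ++ m ++ v ∈ language X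

/-- A synchronized system: an irreducible subshift possessing a synchronizing word. -/
def IsSynchronizedSystem (X : Set (ℤ → A)) : Prop :=
  IrreducibleSubshift X ∧ ∃ m, IsSynchronizingWord X m

end SubshiftBasics
section Correlation

variable {A : Type*}

/-- `ℓ ∈ (u,w)`: overlap condition when the first symbol of `w` is placed below the
`(|u|-ℓ)`-th symbol of `u` (1-indexed); the overlapping parts agree. -/
def corrIdx (u w : List A) (ℓ : ℕ) : Prop :=
  ℓ < u.length ∧
    ∀ j : ℕ, j ≤ ℓ → j < w.length → u[u.length - 1 - ℓ + j]? = w[j]?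

/-- The correlation set `(u,w) ⊆ {0,…,|u|−1}`. -/
def corrSet (u w : List A) : Set ℕ := { ℓ | corrIdx u w ℓ }

open scoped Classical in
/-- The correlation set, as a finset. -/
noncomputable def corrFinset (u w : List A) : Finset ℕ :=
  (Finset.range u.length).filter (corrIdx u w)

/-- The correlation polynomial `(u,w)_z = Σ_{ℓ ∈ (u,w)} z^ℓ`. -/
noncomputable def corrPoly (u w : List A) (z : ℝ) : ℝ :=
  ∑ ℓ ∈ corrFinset u w, z ^ ℓ

end Correlation

/-- The length-`n` prefix `x_1 ⋯ x_n` of a one-sided sequence. -/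
def prefixWord {A : Type*} (x : ℕ → A) (n : ℕ) : List A := (List.range n).map x

/-- The correlation matrix `M_n(z)` of the length-`n` prefixes of `k` one-sided
sequences: `(i,j)` entry `(w_{j,n}, w_{i,n})_z`. -/
noncomputable def corrMatrix {N k : ℕ} (x : Fin k → ℕ → Fin N) (n : ℕ) (z : ℝ) :
    Matrix (Fin k) (Fin k) ℝ :=
  Matrix.of fun i j => corrPoly (prefixWord (x j) n) (prefixWord (x i) n) z

/-- The collection `K_n` of the length-`n` prefixes of the given sequences. -/
def prefixFamily {N k : ℕ} (x : Fin k → ℕ → Fin N) (n : ℕ) : Set (List (Fin N)) :=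
  { v | ∃ i : Fin k, v = prefixWord (x i) n }

/-- `s_n(z)`: the sum of the entries of `M_n(z)⁻¹`. -/
noncomputable def snSum {N k : ℕ} (x : Fin k → ℕ → Fin N) (n : ℕ) (z : ℝ) : ℝ :=
  ∑ i : Fin k, ∑ j : Fin k, (corrMatrix x n z)⁻¹ i j

section Combinatorics

variable {A ι : Type*}

/-- No word of `K` is a factor of the finite word `v`. -/
def Avoids (K : Set (List A)) (v : List A) : Prop := ∀ w ∈ K, ¬ w <:+: v

/-- The words of length `m` avoiding `K`. -/
def avoidingWords (K : Set (List A)) (m : ℕ) : Set (List A) :=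
  { v | v.length = m ∧ Avoids K v }

/-- The words of length `m` beginning with `w` whose tail avoids `K`. -/
def leadingWords (K : Set (List A)) (w : List A) (m : ℕ) : Set (List A) :=
  { v | v.length = m ∧ w <+: v ∧ Avoids K v.tail }

lemma Avoids.of_infix {K : Set (List A)} {u v : List A} (hv : Avoids K v) (h : u <:+: v) :
    Avoids K u := fun w hw hwu => hv w hw (hwu.trans h)

lemma finite_avoidingWords [Finite A] (K : Set (List A)) (m : ℕ) : (avoidingWords K m).Finite :=
  (List.finite_length_eq A m).subset fun _ hv => hv.1

lemma finite_leadingWords [Finite A] (K : Set (List A)) (w : List A) (m : ℕ) :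
    (leadingWords K w m).Finite :=
  (List.finite_length_eq A m).subset fun _ hv => hv.1

lemma ncard_length_eq [Fintype A] (m : ℕ) :
    {v : List A | v.length = m}.ncard = Fintype.card A ^ m := by
  rw [← card_vector (α := A) m, ← Nat.card_eq_fintype_card]
  rfl

lemma ncard_le_of_take_drop {S T U : Set (List A)} (l : ℕ) (hT : T.Finite) (hU : U.Finite)
    (htake : ∀ v ∈ S, v.take l ∈ T) (hdrop : ∀ v ∈ S, v.drop l ∈ U) :
    S.ncard ≤ T.ncard * U.ncard := by
  rw [← Set.ncard_prod]
  refine Set.ncard_le_ncard_of_injOn (fun v => (v.take l, v.drop l))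
    (fun v hv => ⟨htake v hv, hdrop v hv⟩) (fun u _ v _ h => ?_) (hT.prod hU)
  rw [← List.take_append_drop l u, ← List.take_append_drop l v]
  simp only [Prod.mk.injEq] at h
  rw [h.1, h.2]

lemma ncard_avoidingWords_add_le [Finite A] (K : Set (List A)) (l m : ℕ) :
    (avoidingWords K (l + m)).ncard ≤ (avoidingWords K l).ncard * (avoidingWords K m).ncard := by
  refine ncard_le_of_take_drop l (finite_avoidingWords K l) (finite_avoidingWords K m) ?_ ?_
  · rintro v ⟨hv, hav⟩
    exact ⟨by simp [hv], hav.of_infix (List.take_prefix l v).isInfix⟩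
  · rintro v ⟨hv, hav⟩
    exact ⟨by simp [hv], hav.of_infix (List.drop_suffix l v).isInfix⟩

/-- Words whose tail avoids a family of words of equal length either avoid the family
or begin with exactly one of its members. -/
lemma ncard_eq_avoids_add_sum_prefix [Fintype ι] {w : ι → List A} {n : ℕ} (hn : 1 ≤ n)
    (hlen : ∀ i, (w i).length = n) (hw : Function.Injective w) {S : Set (List A)}
    (hS : S.Finite) (htail : ∀ v ∈ S, Avoids (Set.range w) v.tail) :
    S.ncard = (S ∩ {v | Avoids (Set.range w) v}).ncard
      + ∑ i, (S ∩ {v | w i <+: v}).ncard := by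
  have hfin : ∀ i, (S ∩ {v | w i <+: v}).Finite := fun i => hS.inter_of_left _
  have hdisj : Pairwise (Function.onFun Disjoint fun i => S ∩ {v | w i <+: v}) := by
    intro i j hij
    refine Set.disjoint_left.2 fun v hi hj => hij (hw ?_)
    exact (List.prefix_of_prefix_length_le hi.2 hj.2 (by simp [hlen])).eq_of_length
      (by simp [hlen])
  rw [← finsum_eq_sum_of_fintype, ← Set.ncard_iUnion_of_finite hfin hdisj,
    ← Set.ncard_union_eq _ (hS.inter_of_left _) (Set.finite_iUnion hfin)]
  · congr 1
    ext v
    simp only [Set.mem_union, Set.mem_inter_iff, Set.mem_ofPred_eq, Set.mem_iUnion]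
    constructor
    · intro hv
      by_cases hav : Avoids (Set.range w) v
      · exact Or.inl ⟨hv, hav⟩
      · right
        simp only [Avoids, Set.forall_mem_range, not_forall, not_not] at hav
        obtain ⟨i, hi⟩ := hav
        refine ⟨i, hv, ?_⟩
        cases v with
        | nil =>
          have := hi.length_le
          simp only [hlen, List.length_nil] at this
          omega
        | cons a u =>
          rcases List.infix_cons_iff.1 hi with h | h
          · exact h
          · exact absurd h (htail _ hv (w i) ⟨i, rfl⟩)
    · rintro (h | ⟨i, h⟩)
      exacts [h.1, h.1]
  · rw [Set.disjoint_left]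
    intro v hv hv'
    obtain ⟨i, hi⟩ := Set.mem_iUnion.1 hv'
    exact hv.2 (w i) ⟨i, rfl⟩ hi.2.isInfix

lemma ncard_tail_avoids [Fintype A] (K : Set (List A)) (m : ℕ) :
    {v : List A | v.length = m + 1 ∧ Avoids K v.tail}.ncard
      = Fintype.card A * (avoidingWords K m).ncard := by
  have h : {v : List A | v.length = m + 1 ∧ Avoids K v.tail}
      = (fun p : A × List A => p.1 :: p.2) '' (Set.univ ×ˢ avoidingWords K m) := by
    ext v
    cases v with
    | nil => simp
    | cons a u => simp [avoidingWords]
  rw [h, Set.ncard_image_of_injective, Set.ncard_prod, Set.ncard_univ, Nat.card_eq_fintype_card]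
  rintro ⟨a, u⟩ ⟨b, v⟩ h
  simpa using h

lemma ncard_avoidingWords_succ_add [Fintype A] [Fintype ι] {w : ι → List A} {n : ℕ} (hn : 1 ≤ n)
    (hlen : ∀ i, (w i).length = n) (hw : Function.Injective w) (m : ℕ) :
    (avoidingWords (Set.range w) (m + 1)).ncard
      + ∑ i, (leadingWords (Set.range w) (w i) (m + 1)).ncard
      = Fintype.card A * (avoidingWords (Set.range w) m).ncard := by
  rw [← ncard_tail_avoids, ncard_eq_avoids_add_sum_prefix hn hlen hw
    (S := {v | v.length = m + 1 ∧ Avoids (Set.range w) v.tail})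
    ((List.finite_length_eq A (m + 1)).subset fun v hv => hv.1) fun v hv => hv.2]
  refine congrArg₂ _ (congrArg _ ?_) (Finset.sum_congr rfl fun i _ => congrArg _ ?_)
  · ext v
    exact ⟨fun h => ⟨⟨h.1, h.2.of_infix (List.tail_suffix v).isInfix⟩, h.2⟩,
      fun h => ⟨h.1.1, h.2⟩⟩
  · ext v
    exact ⟨fun h => ⟨⟨h.1, h.2.2⟩, h.2.1⟩, fun h => ⟨h.1.1, h.2, h.1.2⟩⟩

lemma lt_length_of_mem_corrFinset {u w : List A} {ℓ : ℕ} (h : ℓ ∈ corrFinset u w) :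
    ℓ < u.length := by
  classical
  exact Finset.mem_range.1 (Finset.mem_filter.1 h).1

lemma corrIdx_iff_drop_prefix {u w : List A} {ℓ : ℕ} (hlen : w.length = u.length) :
    corrIdx u w ℓ ↔ ℓ < u.length ∧ u.drop (u.length - 1 - ℓ) <+: w := by
  refine and_congr_right fun hℓ => ?_
  rw [List.prefix_iff_getElem?]
  constructor
  · intro h j hj
    rw [List.length_drop] at hj
    rw [← h j (by omega) (by omega), ← List.getElem?_drop, List.getElem?_eq_getElem]
  · intro h j hj hjw
    rw [← List.getElem?_drop, h j (by simp; omega), List.getElem?_eq_getElem]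

/-- The words `u` of length `m` such that prepending the last `t` letters of `w` to `u` gives a
word avoiding `K`. -/
def extensionWords (K : Set (List A)) (w : List A) (m t : ℕ) : Set (List A) :=
  { u | u.length = m ∧ Avoids K (w.drop (w.length - t) ++ u) }

lemma ncard_extensionWords [Finite A] [Fintype ι] {w : ι → List A} {n : ℕ}
    (hlen : ∀ i, (w i).length = n) (hw : Function.Injective w) (j : ι) (m ℓ : ℕ) (hℓ : ℓ < n)
    [∀ i, Decidable (corrIdx (w j) (w i) ℓ)] :
    (extensionWords (Set.range w) (w j) m ℓ).ncard
      = (extensionWords (Set.range w) (w j) m (ℓ + 1)).ncard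
        + ∑ i, if corrIdx (w j) (w i) ℓ
            then (leadingWords (Set.range w) (w i) (m + ℓ + 1)).ncard else 0 := by
  set p := (w j).drop (n - (ℓ + 1)) with hp
  have hplen : p.length = ℓ + 1 := by simp [hp, hlen]; omega
  have hptail : p.tail = (w j).drop (n - ℓ) := by
    rw [hp, List.tail_drop]; congr 1; omega
  have hpne : p ≠ [] := by rintro h; simp [h] at hplen
  have hinj : Function.Injective (fun u : List A => p ++ u) := List.append_right_injective p
  have htail : ∀ u : List A, (p ++ u).tail = p.tail ++ u := fun u =>
    List.tail_append_of_ne_nil hpne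
  have hfin : (extensionWords (Set.range w) (w j) m ℓ).Finite :=
    (List.finite_length_eq A m).subset fun v hv => hv.1
  rw [← Set.ncard_image_of_injective _ hinj, ncard_eq_avoids_add_sum_prefix (by omega) hlen hw
    (hfin.image _)]
  swap
  · rintro _ ⟨u, hu, rfl⟩
    simpa [htail, hptail, extensionWords, hlen] using hu.2
  congr 1
  · rw [← Set.ncard_image_of_injective (extensionWords _ _ m (ℓ + 1)) hinj]
    congr 1
    ext v
    constructor
    · rintro ⟨⟨u, hu, rfl⟩, hv⟩
      exact ⟨u, ⟨hu.1, by simpa [hlen] using hv⟩, rfl⟩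
    · rintro ⟨u, hu, rfl⟩
      have hu2 : Avoids (Set.range w) (p ++ u) := by simpa [hlen] using hu.2
      refine ⟨⟨u, ⟨hu.1, ?_⟩, rfl⟩, hu2⟩
      rw [hlen, ← hptail, ← htail]
      exact hu2.of_infix (List.tail_suffix _).isInfix
  · refine Finset.sum_congr rfl fun i _ => ?_
    have hcorr : corrIdx (w j) (w i) ℓ ↔ p <+: w i := by
      rw [corrIdx_iff_drop_prefix (by simp [hlen])]
      simp only [hlen, hℓ, true_and, hp]
      rw [show n - 1 - ℓ = n - (ℓ + 1) by omega]
    split_ifs with h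
    · rw [hcorr] at h
      congr 1
      ext v
      constructor
      · rintro ⟨⟨u, hu, rfl⟩, hv⟩
        refine ⟨by simp [hplen, hu.1]; omega, hv, ?_⟩
        simpa [htail, hptail, hlen] using hu.2
      · rintro ⟨hv1, hv2, hv3⟩
        obtain ⟨u, rfl⟩ := h.trans hv2
        refine ⟨⟨u, ⟨?_, ?_⟩, rfl⟩, hv2⟩
        · simp [hplen] at hv1; omega
        · rw [hlen, ← hptail, ← htail]; exact hv3
    · rw [Set.ncard_eq_zero ((hfin.image _).inter_of_left _), Set.eq_empty_iff_forall_notMem]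
      rintro _ ⟨⟨u, hu, rfl⟩, hv⟩
      rw [hcorr] at h
      exact h (List.prefix_of_prefix_length_le (List.prefix_append p u) hv
        (by rw [hplen, hlen]; omega))

lemma ncard_avoidingWords_eq_sum_corr [Finite A] [Fintype ι] {w : ι → List A} {n : ℕ}
    (hlen : ∀ i, (w i).length = n) (hw : Function.Injective w) (j : ι) (m : ℕ) :
    (avoidingWords (Set.range w) m).ncard
      = ∑ i, ∑ ℓ ∈ corrFinset (w j) (w i),
          (leadingWords (Set.range w) (w i) (m + ℓ + 1)).ncard := by
  classical
  have key : ∀ t ≤ n, (avoidingWords (Set.range w) m).ncard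
      = (extensionWords (Set.range w) (w j) m t).ncard
        + ∑ ℓ ∈ Finset.range t, ∑ i, if corrIdx (w j) (w i) ℓ
            then (leadingWords (Set.range w) (w i) (m + ℓ + 1)).ncard else 0 := by
    intro t
    induction t with
    | zero => intro _; simp [extensionWords, avoidingWords]
    | succ t ih =>
      intro ht
      rw [ih (by omega), ncard_extensionWords hlen hw j m t (by omega), Finset.sum_range_succ]
      ring
  have hempty : extensionWords (Set.range w) (w j) m n = ∅ := by
    rw [Set.eq_empty_iff_forall_notMem]
    rintro u ⟨-, hu⟩
    refine hu (w j) ⟨j, rfl⟩ ?_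
    simpa [hlen] using (List.prefix_append (w j) u).isInfix
  rw [key n le_rfl, hempty, Set.ncard_empty, zero_add, Finset.sum_comm]
  refine Finset.sum_congr rfl fun i _ => ?_
  rw [corrFinset, Finset.sum_filter, hlen]

end Combinatorics

section Entropy

variable {A : Type*}

/-- The word of length `m` read in `x` from position `i`. -/
def window (x : ℤ → A) (i : ℤ) (m : ℕ) : List A := List.ofFn fun t : Fin m => x (i + (t : ℕ))

@[simp] lemma length_window (x : ℤ → A) (i : ℤ) (m : ℕ) : (window x i m).length = m := by
  simp [window]

@[simp] lemma getElem_window (x : ℤ → A) (i : ℤ) (m t : ℕ) (h : t < (window x i m).length) :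
    (window x i m)[t] = x (i + t) := by
  simp [window]

lemma window_add (x : ℤ → A) (i : ℤ) (l m : ℕ) :
    window x i (l + m) = window x i l ++ window x (i + l) m := by
  refine List.ext_getElem (by simp) fun t h₁ h₂ => ?_
  rw [List.getElem_append]
  split_ifs with h
  · simp
  · simp only [length_window] at h
    simp only [getElem_window, length_window]
    congr 1
    push_cast [Nat.cast_sub (not_lt.1 h)]
    ring

lemma window_infix (x : ℤ → A) {i j : ℤ} {l m : ℕ} (hij : i ≤ j) (hlm : j + l ≤ i + m) :
    window x j l <:+: window x i m := by
  obtain ⟨p, hp⟩ := Int.eq_ofNat_of_zero_le (sub_nonneg.2 hij)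
  obtain ⟨q, rfl⟩ : ∃ q, m = p + l + q := ⟨m - (p + l), by omega⟩
  rw [window_add, window_add, show i + (p : ℤ) = j by omega]
  exact List.infix_append _ _ _

lemma occursIn_iff_window {w : List A} {x : ℤ → A} :
    occursIn w x ↔ ∃ i, window x i w.length = w := by
  refine exists_congr fun i => ?_
  constructor
  · intro h
    refine List.ext_getElem (by simp) fun t h₁ h₂ => ?_
    simpa using h ⟨t, h₂⟩
  · intro h t
    rw [List.get_eq_getElem]
    conv_rhs => rw [← List.getElem_of_eq h (by simp)]
    simp

lemma occursIn_of_infix_window {w : List A} {x : ℤ → A} {i : ℤ} {m : ℕ}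
    (h : w <:+: window x i m) : occursIn w x := by
  obtain ⟨a, b, h⟩ := h
  have hm : m = a.length + w.length + b.length := by
    have := congrArg List.length h
    simp only [List.length_append, length_window] at this
    omega
  subst hm
  rw [window_add, window_add] at h
  have h₁ := List.append_inj_left h (by simp)
  exact occursIn_iff_window.2 ⟨_, (List.append_inj_right h₁ (by simp)).symm⟩

lemma langN_perturbFamily_subset (K : Set (List A)) (m : ℕ) :
    langN (perturbFamily Set.univ K) m ⊆ avoidingWords K m := by
  rintro v ⟨⟨x, hx, hv⟩, rfl⟩
  refine ⟨rfl, fun w hw hwv => hx.2 w hw ?_⟩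
  obtain ⟨i, hi⟩ := occursIn_iff_window.1 hv
  rw [← hi] at hwv
  exact occursIn_of_infix_window hwv

lemma isClosed_window_mem [TopologicalSpace A] [DiscreteTopology A] (i : ℤ) (m : ℕ)
    (S : Set (List A)) : IsClosed {x : ℤ → A | window x i m ∈ S} := by
  have hc : Continuous fun (x : ℤ → A) (t : Fin m) => x (i + (t : ℕ)) := by fun_prop
  exact (isClosed_discrete {f : Fin m → A | List.ofFn f ∈ S}).preimage hc

lemma mem_langN_of_forall_extension [Finite A] [Nonempty A] {K : Set (List A)} {v : List A}
    (h : ∀ L : ℕ, ∃ a b : List A, a.length = L ∧ b.length = L ∧ Avoids K (a ++ v ++ b)) :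
    v ∈ langN (perturbFamily Set.univ K) v.length := by
  let _ : TopologicalSpace A := ⊥
  have : DiscreteTopology A := ⟨rfl⟩
  inhabit A
  let C : ℕ → Set (ℤ → A) := fun L =>
    {x | window x 0 v.length ∈ ({v} : Set (List A))} ∩
      {x | window x (-L) (v.length + 2 * L) ∈ {u | Avoids K u}}
  have hclosed : ∀ L, IsClosed (C L) := fun L =>
    (isClosed_window_mem _ _ _).inter (isClosed_window_mem _ _ _)
  have hnonempty : ∀ L, (C L).Nonempty := by
    intro L
    obtain ⟨a, b, ha, hb, hab⟩ := h L
    refine ⟨fun t => (a ++ v ++ b).getD (t + L).toNat default, ?_, ?_⟩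
    · refine List.ext_getElem (by simp) fun t h₁ h₂ => ?_
      have e : ((0 : ℤ) + t + L).toNat = t + L := by omega
      rw [getElem_window, e, List.getD_eq_getElem _ _ (by simp; omega)]
      simp [ha, h₂]
    · suffices hw : window (fun t : ℤ => (a ++ v ++ b).getD (t + L).toNat default) (-L)
          (v.length + 2 * L) = a ++ v ++ b by
        change Avoids K _
        rwa [hw]
      refine List.ext_getElem (by simp; omega) fun t h₁ h₂ => ?_
      have e : (-(L : ℤ) + t + L).toNat = t := by omega
      rw [getElem_window, e, List.getD_eq_getElem]
  obtain ⟨x, hx⟩ := IsCompact.nonempty_iInter_of_sequence_nonempty_isCompact_isClosed C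
    (fun L x hx => ⟨hx.1, Avoids.of_infix hx.2
      (window_infix x (by push_cast; omega) (by push_cast; omega))⟩)
    hnonempty (hclosed 0).isCompact hclosed
  rw [Set.mem_iInter] at hx
  refine ⟨⟨x, ⟨trivial, fun w hw hocc => ?_⟩, occursIn_iff_window.2 ⟨0, (hx 0).1⟩⟩, rfl⟩
  obtain ⟨i, hi⟩ := occursIn_iff_window.1 hocc
  refine (hx (i.natAbs + w.length)).2 w hw ?_
  have hsub : window x i w.length <:+: window x (-((i.natAbs + w.length : ℕ) : ℤ))
      (v.length + 2 * (i.natAbs + w.length)) := window_infix x (by omega) (by omega)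
  rwa [hi] at hsub

lemma exists_extension_bound [Finite A] [Nonempty A] (K : Set (List A)) (m : ℕ) :
    ∃ L : ℕ, ∀ v a b : List A, v.length = m → a.length = L → b.length = L →
      Avoids K (a ++ v ++ b) → v ∈ langN (perturbFamily Set.univ K) m := by
  have hv : ∀ v : List A, ∃ L : ℕ, v.length = m → v ∉ langN (perturbFamily Set.univ K) m →
      ∀ a b : List A, a.length = L → b.length = L → ¬ Avoids K (a ++ v ++ b) := by
    intro v
    by_contra! hcon
    obtain ⟨rfl, hnot, -⟩ := hcon 0
    refine hnot (mem_langN_of_forall_extension fun L => ?_)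
    obtain ⟨-, -, a, b, h⟩ := hcon L
    exact ⟨a, b, h⟩
  choose L hL using hv
  obtain ⟨B, hB⟩ := ((List.finite_length_eq A m).image L).bddAbove
  refine ⟨B, fun v a b hvm ha hb hav => ?_⟩
  by_contra hnot
  have hLB : L v ≤ B := hB ⟨v, hvm, rfl⟩
  refine hL v hvm hnot (a.drop (B - L v)) (b.take (L v)) (by simp [ha]; omega) (by simp [hb, hLB])
    (hav.of_infix ⟨a.take (B - L v), b.drop (L v), ?_⟩)
  simp only [← List.append_assoc, List.take_append_drop]
  simp only [List.append_assoc, List.take_append_drop]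

lemma pow_le_ncard_langN [Finite A] [Nonempty A] {K : Set (List A)} {r : ℝ} (hr : 0 < r)
    (h : ∀ m, r ^ m ≤ (avoidingWords K m).ncard) (m : ℕ) :
    r ^ m ≤ (langN (perturbFamily Set.univ K) m).ncard := by
  obtain ⟨L, hL⟩ := exists_extension_bound K m
  have hfin : ∀ l, {v : List A | v.length = l}.Finite := List.finite_length_eq A
  set c := (langN (perturbFamily Set.univ K) m).ncard with hc
  set M := {v : List A | v.length = L}.ncard with hM
  let D : ℕ → Set (List A) := fun q =>
    {v | v.length = q * m ∧ ∃ a b : List A, a.length = L ∧ b.length = L ∧ Avoids K (a ++ v ++ b)}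
  have hD : ∀ q, (D q).Finite := fun q => (hfin (q * m)).subset fun v hv => hv.1
  have hstep : ∀ q, (D (q + 1)).ncard ≤ c * (D q).ncard := by
    intro q
    refine ncard_le_of_take_drop m ((hfin m).subset fun v hv => hv.2) (hD q) ?_ ?_
    · rintro v ⟨hv, a, b, ha, hb, hav⟩
      rw [add_mul, one_mul] at hv
      refine hL _ a ((v.drop m ++ b).take L) (by simp [hv]) ha (by simp [hv, hb])
        (hav.of_infix (List.IsPrefix.isInfix ⟨(v.drop m ++ b).drop L, ?_⟩))
      rw [List.append_assoc _ (List.take L _), List.take_append_drop, List.append_assoc,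
        ← List.append_assoc (v.take m), List.take_append_drop, List.append_assoc]
    · rintro v ⟨hv, a, b, ha, hb, hav⟩
      rw [add_mul, one_mul] at hv
      refine ⟨by simp [hv], (a ++ v.take m).drop m, b, by simp [hv, ha], hb,
        hav.of_infix (List.IsSuffix.isInfix ⟨(a ++ v.take m).take m, ?_⟩)⟩
      rw [← List.append_assoc, ← List.append_assoc, List.take_append_drop,
        List.append_assoc a, List.take_append_drop]
  have hpow : ∀ q, (D q).ncard ≤ c ^ q := by
    intro q
    induction q with
    | zero =>
      refine (Set.ncard_le_ncard (t := {[]}) (fun v hv => ?_)).trans (by simp)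
      simpa using hv.1
    | succ q ih =>
      exact (hstep q).trans (by rw [pow_succ']; exact Nat.mul_le_mul_left _ ih)
  have hbound : ∀ q, (avoidingWords K (L + (q * m + L))).ncard ≤ M * (c ^ q * M) := by
    intro q
    let E : Set (List A) := {u | u.length = q * m + L ∧ ∃ a : List A, a.length = L ∧
      Avoids K (a ++ u)}
    have hE : E.ncard ≤ (D q).ncard * M := by
      refine ncard_le_of_take_drop (q * m) (hD q) (hfin L) ?_ ?_
      · rintro u ⟨hu, a, ha, hav⟩
        exact ⟨by simp [hu], a, u.drop (q * m), ha, by simp [hu], by simpa using hav⟩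
      · rintro u ⟨hu, -⟩
        simp [hu]
    refine (ncard_le_of_take_drop L (hfin L)
      ((hfin (q * m + L)).subset fun u (hu : u ∈ E) => hu.1) ?_ ?_).trans
      (Nat.mul_le_mul_left _ (hE.trans (Nat.mul_le_mul_right _ (hpow q))))
    · rintro v ⟨hv, -⟩
      simp [hv]
    · rintro v ⟨hv, hav⟩
      exact ⟨by simp [hv], v.take L, by simp [hv], by simpa using hav⟩
  by_contra! hlt
  have hMpos : (0 : ℝ) < M := by
    have : 0 < M := (Set.ncard_pos (hfin L)).2 ⟨List.replicate L (Classical.arbitrary A), by simp⟩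
    exact_mod_cast this
  obtain ⟨q, hq⟩ := exists_pow_lt_of_lt_one (x := r ^ (2 * L) / (M * M)) (y := c / r ^ m)
    (by positivity) ((div_lt_one (by positivity)).2 hlt)
  have h1 : r ^ (L + (q * m + L)) ≤ M * (c ^ q * M) :=
    (h _).trans (by exact_mod_cast hbound q)
  rw [div_pow, div_lt_div_iff₀ (by positivity) (by positivity), ← pow_mul, ← pow_add] at hq
  rw [show L + (q * m + L) = 2 * L + m * q by ring] at h1
  linarith

lemma entropy_perturbFamily_eq_log [Finite A] [Nonempty A] {K : Set (List A)} {r : ℝ} (hr : 0 < r)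
    (h : ∀ m, r ^ m ≤ (avoidingWords K m).ncard)
    (hlim : Tendsto (fun m : ℕ => Real.log (avoidingWords K m).ncard / m) atTop (𝓝 (Real.log r))) :
    entropy (perturbFamily Set.univ K) = Real.log r := by
  refine Tendsto.limsup_eq (tendsto_of_tendsto_of_tendsto_of_le_of_le' tendsto_const_nhds hlim ?_ ?_)
  · filter_upwards [eventually_gt_atTop 0] with m hm
    rw [le_div_iff₀ (by exact_mod_cast hm), mul_comm, ← Real.log_pow]
    exact Real.log_le_log (by positivity) (pow_le_ncard_langN hr h m)
  · refine Eventually.of_forall fun m => ?_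
    have hpos : (0 : ℝ) < (langN (perturbFamily Set.univ K) m).ncard :=
      (pow_pos hr m).trans_le (pow_le_ncard_langN hr h m)
    refine div_le_div_of_nonneg_right (Real.log_le_log hpos ?_) m.cast_nonneg
    exact_mod_cast Set.ncard_le_ncard (langN_perturbFamily_subset K m)
      (finite_avoidingWords K m)

lemma entropy_univ [Fintype A] [Nonempty A] :
    entropy (Set.univ : Set (ℤ → A)) = Real.log (Fintype.card A) := by
  have hlang : ∀ m, langN (Set.univ : Set (ℤ → A)) m = {v | v.length = m} := by
    intro m
    inhabit A
    ext v
    refine ⟨fun h => h.2, fun h => ⟨⟨fun t => v.getD t.toNat default, trivial, 0, fun t => ?_⟩, h⟩⟩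
    simp
  refine Tendsto.limsup_eq (tendsto_const_nhds.congr' ?_)
  filter_upwards [eventually_gt_atTop 0] with m hm
  have : (m : ℝ) ≠ 0 := by positivity
  rw [hlang, ncard_length_eq, Nat.cast_pow, Real.log_pow, mul_div_cancel_left₀ _ this]

end Entropy

section GeneratingFunction

variable {A ι : Type*}

lemma avoidingWords_zero {w : ι → List A} {n : ℕ} (hn : 1 ≤ n) (hlen : ∀ i, (w i).length = n) :
    avoidingWords (Set.range w) 0 = {[]} := by
  ext v
  rw [Set.mem_singleton_iff]
  refine ⟨fun h => List.length_eq_zero_iff.1 h.1, ?_⟩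
  rintro rfl
  refine ⟨rfl, ?_⟩
  rintro _ ⟨i, rfl⟩ h
  have := h.length_le
  simp only [hlen, List.length_nil] at this
  omega

lemma ncard_leadingWords_eq_zero [Finite A] (K : Set (List A)) {w : List A} {m : ℕ} (hm : m < w.length) :
    (leadingWords K w m).ncard = 0 := by
  rw [Set.ncard_eq_zero (finite_leadingWords K w m), Set.eq_empty_iff_forall_notMem]
  rintro v ⟨rfl, hv, -⟩
  exact absurd hv.length_le (not_le.2 hm)

/-- The generating function of the words avoiding a family of words of equal length, in terms of
the sum of the entries of the inverse correlation matrix. -/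
lemma tsum_avoidingWords_mul [Fintype A] [Fintype ι] [DecidableEq ι] {w : ι → List A} {n : ℕ} (hn : 1 ≤ n)
    (hlen : ∀ i, (w i).length = n) (hw : Function.Injective w) {z : ℝ} (hz : 0 < z)
    (hsum : Summable fun m : ℕ => ((avoidingWords (Set.range w) m).ncard : ℝ) * z⁻¹ ^ m)
    {M : Matrix ι ι ℝ} (hM : ∀ i j, M i j = corrPoly (w j) (w i) z) (hdet : IsUnit M.det) :
    (∑' m : ℕ, ((avoidingWords (Set.range w) m).ncard : ℝ) * z⁻¹ ^ m)
      * (z - Fintype.card A + ∑ i, ∑ j, M⁻¹ i j) = z := by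
  set f : ℕ → ℝ := fun m => ((avoidingWords (Set.range w) m).ncard : ℝ) with hf
  set g : ι → ℕ → ℝ := fun i m => ((leadingWords (Set.range w) (w i) m).ncard : ℝ) with hg
  set F : ℝ := ∑' m : ℕ, f m * z⁻¹ ^ m with hF
  have hz0 : z ≠ 0 := hz.ne'
  have hf0 : f 0 = 1 := by simp [hf, avoidingWords_zero hn hlen]
  have hrec : ∀ m, f (m + 1) + ∑ i, g i (m + 1) = Fintype.card A * f m := fun m => by
    simp only [hf, hg]
    exact_mod_cast ncard_avoidingWords_succ_add hn hlen hw m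
  have hgsum : ∀ i, Summable fun m => g i m * z⁻¹ ^ m := by
    intro i
    rw [← summable_nat_add_iff 1]
    refine Summable.of_nonneg_of_le (fun m => by positivity) (fun m => ?_)
      (hsum.mul_left (Fintype.card A * z⁻¹))
    have h1 : g i (m + 1) ≤ Fintype.card A * f m := by
      rw [← hrec m]
      have := Finset.single_le_sum (f := fun i => g i (m + 1))
        (fun i _ => by positivity) (Finset.mem_univ i)
      have h2 : 0 ≤ f (m + 1) := by positivity
      linarith
    calc g i (m + 1) * z⁻¹ ^ (m + 1) ≤ (Fintype.card A * f m) * z⁻¹ ^ (m + 1) := by gcongr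
      _ = Fintype.card A * z⁻¹ * (f m * z⁻¹ ^ m) := by ring
  set G : ι → ℝ := fun i => ∑' m, g i m * z⁻¹ ^ m with hG
  have hshift : ∀ i, ∀ l ≤ n, HasSum (fun m => g i (m + l) * z⁻¹ ^ (m + l)) (G i) := by
    intro i l hl
    have h := (hasSum_nat_add_iff' l).2 (hgsum i).hasSum
    rwa [Finset.sum_eq_zero, sub_zero] at h
    intro m hm
    rw [Finset.mem_range] at hm
    simp [hg, ncard_leadingWords_eq_zero (Set.range w) (w := w i) (m := m) (by rw [hlen]; omega)]
  have hF1 : z * (F - 1) + z * ∑ i, G i = Fintype.card A * F := by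
    have h1 : HasSum (fun m => f (m + 1) * z⁻¹ ^ (m + 1)) (F - 1) := by
      have h := (hasSum_nat_add_iff' 1).2 hsum.hasSum
      rwa [Finset.sum_range_one, pow_zero, mul_one, show ((avoidingWords (Set.range w) 0).ncard : ℝ)
        = 1 from hf0] at h
    have h2 : HasSum (fun m => ∑ i, g i (m + 1) * z⁻¹ ^ (m + 1)) (∑ i, G i) :=
      hasSum_sum fun i _ => hshift i 1 hn
    have h3 := (h1.add h2).mul_left z
    rw [← mul_add]
    refine h3.unique ((hsum.hasSum.mul_left (Fintype.card A : ℝ)).congr_fun ?_)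
    intro m
    rw [← Finset.sum_mul, ← add_mul, hrec m]
    rw [pow_succ]
    field_simp
    rfl
  have hF2 : ∀ j, F = z * ∑ i, G i * M i j := by
    intro j
    have h1 : HasSum (fun m => ∑ i, ∑ ℓ ∈ corrFinset (w j) (w i),
        z ^ (ℓ + 1) * (g i (m + (ℓ + 1)) * z⁻¹ ^ (m + (ℓ + 1))))
        (∑ i, ∑ ℓ ∈ corrFinset (w j) (w i), z ^ (ℓ + 1) * G i) := by
      refine hasSum_sum fun i _ => hasSum_sum fun ℓ hℓ => (hshift i _ ?_).mul_left _
      have := lt_length_of_mem_corrFinset hℓ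
      rw [hlen] at this
      omega
    have h2 : HasSum (fun m => f m * z⁻¹ ^ m)
        (∑ i, ∑ ℓ ∈ corrFinset (w j) (w i), z ^ (ℓ + 1) * G i) := by
      refine h1.congr_fun fun m => ?_
      simp only [hf, hg]
      rw [ncard_avoidingWords_eq_sum_corr hlen hw j m]
      push_cast
      rw [Finset.sum_mul]
      refine Finset.sum_congr rfl fun i _ => ?_
      rw [Finset.sum_mul]
      refine Finset.sum_congr rfl fun ℓ _ => ?_
      rw [add_assoc, pow_add z⁻¹, inv_pow z (ℓ + 1)]
      field_simp
    rw [hF, h2.tsum_eq, Finset.mul_sum]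
    refine Finset.sum_congr rfl fun i _ => ?_
    rw [hM, corrPoly, Finset.mul_sum, Finset.mul_sum]
    exact Finset.sum_congr rfl fun ℓ _ => by ring
  have hvec : Matrix.vecMul G M = fun _ => F / z := by
    ext j
    rw [eq_div_iff hz0, hF2 j, mul_comm]
    rfl
  have hGeq : G = Matrix.vecMul (fun _ => F / z) M⁻¹ := by
    rw [← hvec, Matrix.vecMul_vecMul, Matrix.mul_nonsing_inv _ hdet, Matrix.vecMul_one]
  have hGsum : ∑ i, G i = F / z * ∑ i, ∑ j, M⁻¹ i j := by
    rw [hGeq, Finset.mul_sum]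
    simp only [Matrix.vecMul, dotProduct, Finset.mul_sum]
    exact Finset.sum_comm
  rw [hGsum] at hF1
  field_simp at hF1
  linarith

lemma card_sub_lt_sum_inv [Fintype A] [Fintype ι] [DecidableEq ι] {w : ι → List A} {n : ℕ} (hn : 1 ≤ n)
    (hlen : ∀ i, (w i).length = n) (hw : Function.Injective w) {z : ℝ} (hz : 0 < z)
    (hsum : Summable fun m : ℕ => ((avoidingWords (Set.range w) m).ncard : ℝ) * z⁻¹ ^ m)
    {M : Matrix ι ι ℝ} (hM : ∀ i j, M i j = corrPoly (w j) (w i) z) (hdet : IsUnit M.det) :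
    Fintype.card A - z < ∑ i, ∑ j, M⁻¹ i j := by
  have h := tsum_avoidingWords_mul hn hlen hw hz hsum hM hdet
  have h1 := pos_of_mul_pos_right (h ▸ hz) (tsum_nonneg fun m => by positivity)
  linarith

lemma sum_inv_le_card_sub [Fintype A] [Fintype ι] [DecidableEq ι] {w : ι → List A} {n : ℕ} (hn : 1 ≤ n)
    (hlen : ∀ i, (w i).length = n) (hw : Function.Injective w) {r z : ℝ} (hr : 0 < r) (hrz : r < z)
    (hle : ∀ m, r ^ m ≤ (avoidingWords (Set.range w) m).ncard)
    (hsum : Summable fun m : ℕ => ((avoidingWords (Set.range w) m).ncard : ℝ) * z⁻¹ ^ m)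
    {M : Matrix ι ι ℝ} (hM : ∀ i j, M i j = corrPoly (w j) (w i) z) (hdet : IsUnit M.det) :
    ∑ i, ∑ j, M⁻¹ i j ≤ Fintype.card A - r := by
  have hz : 0 < z := hr.trans hrz
  have h := tsum_avoidingWords_mul hn hlen hw hz hsum hM hdet
  have h1 := card_sub_lt_sum_inv hn hlen hw hz hsum hM hdet
  set F := ∑' m : ℕ, ((avoidingWords (Set.range w) m).ncard : ℝ) * z⁻¹ ^ m
  set s := ∑ i, ∑ j, M⁻¹ i j
  have hlt : r * z⁻¹ < 1 := by rw [← div_eq_mul_inv]; exact (div_lt_one hz).2 hrz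
  have hge : (1 - r * z⁻¹)⁻¹ ≤ F := by
    rw [← tsum_geometric_of_lt_one (by positivity) hlt]
    refine Summable.tsum_le_tsum (fun m => ?_) (summable_geometric_of_lt_one (by positivity) hlt)
      hsum
    rw [mul_pow]
    exact mul_le_mul_of_nonneg_right (hle m) (by positivity)
  have h2 : (1 - r * z⁻¹)⁻¹ * (z - Fintype.card A + s) ≤ z :=
    (mul_le_mul_of_nonneg_right hge (by linarith)).trans h.le
  rw [inv_mul_le_iff₀ (by linarith)] at h2
  have h3 : (1 - r * z⁻¹) * z = z - r := by field_simp
  linarith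

lemma summable_of_ncard_eq_zero [Finite A] {K : Set (List A)} {m : ℕ} (h : (avoidingWords K m).ncard = 0)
    (y : ℝ) : Summable fun m : ℕ => ((avoidingWords K m).ncard : ℝ) * y ^ m := by
  refine summable_of_ne_finset_zero (s := Finset.range m) fun l hl => ?_
  rw [Finset.mem_range, not_lt] at hl
  have hle := ncard_avoidingWords_add_le K m (l - m)
  rw [h, zero_mul, Nat.add_sub_cancel' hl] at hle
  simp [Nat.le_zero.1 hle]

lemma exists_growth_rate [Finite A] {K : Set (List A)} (h : ∀ m, (avoidingWords K m).ncard ≠ 0) :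
    ∃ r : ℝ, 0 < r ∧ (∀ m, r ^ m ≤ (avoidingWords K m).ncard) ∧
      Tendsto (fun m : ℕ => Real.log (avoidingWords K m).ncard / m) atTop (𝓝 (Real.log r)) ∧
      ∀ z, r < z → Summable fun m : ℕ => ((avoidingWords K m).ncard : ℝ) * z⁻¹ ^ m := by
  have hpos : ∀ m, (0 : ℝ) < (avoidingWords K m).ncard := fun m =>
    Nat.cast_pos.2 (Nat.pos_of_ne_zero (h m))
  have hone : ∀ m, (1 : ℝ) ≤ (avoidingWords K m).ncard := fun m =>
    Nat.one_le_cast.2 (Nat.pos_of_ne_zero (h m))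
  have hsub : Subadditive fun m : ℕ => Real.log (avoidingWords K m).ncard := by
    intro l m
    rw [← Real.log_mul (hpos l).ne' (hpos m).ne']
    exact Real.log_le_log (hpos _) (by exact_mod_cast ncard_avoidingWords_add_le K l m)
  have hbdd : BddBelow (Set.range fun m : ℕ => Real.log (avoidingWords K m).ncard / m) := by
    refine ⟨0, ?_⟩
    rintro _ ⟨m, rfl⟩
    exact div_nonneg (Real.log_nonneg (hone m)) m.cast_nonneg
  have hlim := hsub.tendsto_lim hbdd
  refine ⟨Real.exp hsub.lim, Real.exp_pos _, fun m => ?_, by rwa [Real.log_exp], fun z hz => ?_⟩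
  · rcases Nat.eq_zero_or_pos m with rfl | hm
    · simpa using hone 0
    · rw [← Real.exp_nat_mul, ← Real.le_log_iff_exp_le (hpos m), mul_comm,
        ← le_div_iff₀ (by exact_mod_cast hm)]
      exact hsub.lim_le_div hbdd hm.ne'
  · have hz0 : 0 < z := (Real.exp_pos _).trans hz
    obtain ⟨b, hb1, hb2⟩ := exists_between ((Real.lt_log_iff_exp_lt hz0).2 hz)
    have hbz : Real.exp b * z⁻¹ < 1 := by
      rw [← div_eq_mul_inv, div_lt_one hz0]
      exact (Real.lt_log_iff_exp_lt hz0).1 hb2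
    refine Summable.of_norm_bounded_eventually_nat
      (summable_geometric_of_lt_one (by positivity) hbz) ?_
    filter_upwards [hlim.eventually_lt_const hb1, eventually_gt_atTop 0] with m hm hm0
    rw [Real.norm_of_nonneg (by positivity), mul_pow]
    refine mul_le_mul_of_nonneg_right ?_ (by positivity)
    rw [div_lt_iff₀ (by exact_mod_cast hm0)] at hm
    rw [← Real.exp_nat_mul, ← Real.log_le_iff_le_exp (hpos m)]
    linarith

end GeneratingFunction

section Asymptotics

lemma corrPoly_bounds {A : Type*} (u w : List A) {b z c C : ℝ} (hb : 0 < b) (hz : 0 < z)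
    (hc1 : c ≤ 1) (hc : c ≤ (z / b) ^ u.length) (hC1 : 1 ≤ C) (hC : (z / b) ^ u.length ≤ C) :
    c * corrPoly u w b ≤ corrPoly u w z ∧ corrPoly u w z ≤ C * corrPoly u w b := by
  have hq : 0 < z / b := div_pos hz hb
  have hterm : ∀ ℓ ∈ corrFinset u w,
      c * b ^ ℓ ≤ z ^ ℓ ∧ z ^ ℓ ≤ C * b ^ ℓ := by
    intro ℓ hℓ
    have hlt : ℓ < u.length := lt_length_of_mem_corrFinset hℓ
    have hzb : z ^ ℓ = (z / b) ^ ℓ * b ^ ℓ := by rw [← mul_pow, div_mul_cancel₀ _ hb.ne']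
    rw [hzb]
    constructor <;> refine mul_le_mul_of_nonneg_right ?_ (by positivity)
    · rcases le_total (z / b) 1 with h | h
      · exact hc.trans (pow_le_pow_of_le_one hq.le h hlt.le)
      · exact hc1.trans (one_le_pow₀ h)
    · rcases le_total (z / b) 1 with h | h
      · exact (pow_le_one₀ hq.le h).trans hC1
      · exact (pow_le_pow_right₀ h hlt.le).trans hC
  simp only [corrPoly, Finset.mul_sum]
  exact ⟨Finset.sum_le_sum fun ℓ hℓ => (hterm ℓ hℓ).1,
    Finset.sum_le_sum fun ℓ hℓ => (hterm ℓ hℓ).2⟩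

lemma length_prefixWord {A : Type*} (x : ℕ → A) (n : ℕ) : (prefixWord x n).length = n := by
  simp [prefixWord]

lemma tendsto_corrMatrix_div {N k : ℕ} (hN : 0 < N) {x : Fin k → ℕ → Fin N} {i j : Fin k} {a : ℝ}
    (ha : Tendsto (fun n : ℕ => corrMatrix x n (N : ℝ) i j / (N : ℝ) ^ n) atTop (𝓝 a))
    {z : ℕ → ℝ} (hz : ∀ᶠ n in atTop, 0 < z n)
    (hlim : Tendsto (fun n => (z n / N) ^ n) atTop (𝓝 1)) :
    Tendsto (fun n => corrMatrix x n (z n) i j / (N : ℝ) ^ n) atTop (𝓝 a) := by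
  have hN' : (0 : ℝ) < N := by exact_mod_cast hN
  have hlow := ((tendsto_const_nhds (x := (1 : ℝ))).min hlim).mul ha
  have hupp := ((tendsto_const_nhds (x := (1 : ℝ))).max hlim).mul ha
  rw [min_self, one_mul] at hlow
  rw [max_self, one_mul] at hupp
  refine tendsto_of_tendsto_of_tendsto_of_le_of_le' hlow hupp ?_ ?_
  all_goals
    filter_upwards [hz] with n hn
    have h := corrPoly_bounds (prefixWord (x j) n) (prefixWord (x i) n) hN' hn
      (min_le_left 1 ((z n / N) ^ n)) (by rw [length_prefixWord]; exact min_le_right _ _)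
      (le_max_left 1 ((z n / N) ^ n)) (by rw [length_prefixWord]; exact le_max_right _ _)
    rw [← mul_div_assoc]
  exacts [div_le_div_of_nonneg_right h.1 (by positivity),
    div_le_div_of_nonneg_right h.2 (by positivity)]

lemma tendsto_sum_inv {ι : Type*} [Fintype ι] [DecidableEq ι] {M : ℕ → Matrix ι ι ℝ}
    {c : ℕ → ℝ} (hc : ∀ n, c n ≠ 0) {α : Matrix ι ι ℝ} (hα : IsUnit α.det)
    (h : ∀ i j, Tendsto (fun n => M n i j / c n) atTop (𝓝 (α i j))) :
    (∀ᶠ n in atTop, IsUnit (M n).det) ∧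
      Tendsto (fun n => (∑ i, ∑ j, (M n)⁻¹ i j) * c n) atTop (𝓝 (∑ i, ∑ j, α⁻¹ i j)) := by
  set B : ℕ → Matrix ι ι ℝ := fun n => (c n)⁻¹ • M n with hB
  have hBlim : Tendsto B atTop (𝓝 α) := by
    refine tendsto_pi_nhds.2 fun i => tendsto_pi_nhds.2 fun j => ?_
    simpa [hB, div_eq_inv_mul] using h i j
  have hdet : Tendsto (fun n => (B n).det) atTop (𝓝 α.det) :=
    ((continuous_id.matrix_det).tendsto α).comp hBlim
  have hadj : Tendsto (fun n => (B n).adjugate) atTop (𝓝 α.adjugate) :=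
    ((continuous_id.matrix_adjugate).tendsto α).comp hBlim
  have hinv : Tendsto (fun n => (B n)⁻¹) atTop (𝓝 α⁻¹) := by
    simp only [Matrix.inv_def, Ring.inverse_eq_inv']
    exact (hdet.inv₀ hα.ne_zero).smul hadj
  have hunit : ∀ᶠ n in atTop, IsUnit (M n).det := by
    filter_upwards [hdet.eventually_ne hα.ne_zero] with n hn
    rw [hB, Matrix.det_smul] at hn
    exact (right_ne_zero_of_mul hn).isUnit
  refine ⟨hunit, ?_⟩
  have hsum : Tendsto (fun n => ∑ i, ∑ j, (B n)⁻¹ i j) atTop (𝓝 (∑ i, ∑ j, α⁻¹ i j)) :=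
    tendsto_finsetSum _ fun i _ => tendsto_finsetSum _ fun j _ =>
      (tendsto_pi_nhds.1 (tendsto_pi_nhds.1 hinv i) j)
  refine hsum.congr' ?_
  filter_upwards [hunit] with n hn
  have hBinv : (B n)⁻¹ = c n • (M n)⁻¹ := by
    refine Matrix.inv_eq_right_inv ?_
    rw [hB, Matrix.smul_mul, Matrix.mul_smul, smul_smul, inv_mul_cancel₀ (hc n), one_smul,
      Matrix.mul_nonsing_inv _ hn]
  simp only [hBinv, Matrix.smul_apply, smul_eq_mul, Finset.sum_mul]
  exact Finset.sum_congr rfl fun i _ => Finset.sum_congr rfl fun j _ => mul_comm _ _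

lemma tendsto_div_pow_one {b : ℝ} (hb : 0 < b) {z : ℕ → ℝ}
    (h : Tendsto (fun n : ℕ => (n : ℝ) * (z n - b)) atTop (𝓝 0)) :
    Tendsto (fun n => (z n / b) ^ n) atTop (𝓝 1) := by
  have h1 : Tendsto (fun n : ℕ => (n : ℝ) * ((z n - b) / b)) atTop (𝓝 0) := by
    simpa [mul_div_assoc] using h.div_const b
  have h2 := Real.tendsto_one_add_pow_exp_of_tendsto h1
  rw [Real.exp_zero] at h2
  refine h2.congr fun n => ?_
  congr 1
  field_simp
  ring

lemma tendsto_log_sub_mul {b T : ℝ} (hb : 0 < b) {r c : ℕ → ℝ} (hc : ∀ n, 0 ≤ c n)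
    (hr : Tendsto r atTop (𝓝 b)) (h : Tendsto (fun n => (b - r n) * c n) atTop (𝓝 T)) :
    Tendsto (fun n => (Real.log b - Real.log (r n)) * c n) atTop (𝓝 (T / b)) := by
  refine tendsto_of_tendsto_of_tendsto_of_le_of_le' (h.div_const b) (h.div hr hb.ne') ?_ ?_
  · filter_upwards [hr.eventually_const_lt hb] with n hn
    have h1 := Real.log_le_sub_one_of_pos (div_pos hn hb)
    rw [Real.log_div hn.ne' hb.ne'] at h1
    have h2 : (b - r n) / b ≤ Real.log b - Real.log (r n) := by
      rw [sub_div, div_self hb.ne']; linarith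
    rw [mul_div_right_comm]
    exact mul_le_mul_of_nonneg_right h2 (hc n)
  · filter_upwards [hr.eventually_const_lt hb] with n hn
    have h1 := Real.log_le_sub_one_of_pos (div_pos hb hn)
    rw [Real.log_div hb.ne' hn.ne'] at h1
    have h2 : Real.log b - Real.log (r n) ≤ (b - r n) / r n := by
      rw [sub_div, div_self hn.ne']; linarith
    rw [Pi.div_apply, mul_div_right_comm]
    exact mul_le_mul_of_nonneg_right h2 (hc n)

end Asymptotics

/-- The local escape rate / exponential decay rate of the entropy drop for the full
shift on `N` symbols perturbed by the length-`n` prefixes of `k` sequences: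
`lim (h(X) − h(X_{K_n}))/N^{−n} = T/N`, with `T` the sum of the entries of `α(N)⁻¹`. -/
theorem fullshift_local_entropy_drop (N k : ℕ) (hN : 2 ≤ N) (x : Fin k → ℕ → Fin N)
    (hdist : ∀ n : ℕ, 1 ≤ n → ∀ i j : Fin k, i ≠ j →
      prefixWord (x i) n ≠ prefixWord (x j) n)
    (α : Matrix (Fin k) (Fin k) ℝ)
    (hα : ∀ i j : Fin k,
      Filter.Tendsto (fun n : ℕ => corrMatrix x n (N : ℝ) i j / (N : ℝ) ^ n)
        Filter.atTop (nhds (α i j)))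
    (hαinv : IsUnit α.det) :
    Filter.Tendsto
      (fun n : ℕ =>
        (entropy (Set.univ : Set (ℤ → Fin N)) -
            entropy (perturbFamily (Set.univ : Set (ℤ → Fin N)) (prefixFamily x n))) *
          (N : ℝ) ^ n)
      Filter.atTop (nhds ((∑ i : Fin k, ∑ j : Fin k, α⁻¹ i j) / N)) := by
  classical
  have hN0 : 0 < N := by omega
  have hNpos : (0 : ℝ) < N := by exact_mod_cast hN0
  have hNone : (1 : ℝ) < N := by exact_mod_cast hN
  have : Nonempty (Fin N) := ⟨⟨0, hN0⟩⟩
  have hK : ∀ n, prefixFamily x n = Set.range fun i => prefixWord (x i) n := fun n => by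
    ext v; simp [prefixFamily, eq_comm]
  have hlen : ∀ n i, (prefixWord (x i) n).length = n := fun n i => length_prefixWord (x i) n
  have hinj : ∀ n, 1 ≤ n → Function.Injective fun i => prefixWord (x i) n := fun n hn i j h => by
    by_contra hij
    exact hdist n hn i j hij h
  have hM : ∀ n z i j, corrMatrix x n z i j = corrPoly (prefixWord (x j) n) (prefixWord (x i) n) z :=
    fun _ _ _ _ => rfl
  have hpow : ∀ n : ℕ, ((N : ℝ) ^ n) ≠ 0 := fun n => pow_ne_zero n hNpos.ne'
  have hs : ∀ z : ℕ → ℝ, (∀ᶠ n in atTop, 0 < z n) →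
      Tendsto (fun n : ℕ => (n : ℝ) * (z n - N)) atTop (𝓝 0) →
      (∀ᶠ n in atTop, IsUnit (corrMatrix x n (z n)).det) ∧
      Tendsto (fun n => (∑ i, ∑ j, (corrMatrix x n (z n))⁻¹ i j) * (N : ℝ) ^ n) atTop
        (𝓝 (∑ i, ∑ j, α⁻¹ i j)) := fun z hz hzN =>
    tendsto_sum_inv hpow hαinv fun i j =>
      tendsto_corrMatrix_div hN0 (hα i j) hz (tendsto_div_pow_one hNpos hzN)
  have hinv_nat : Tendsto (fun n : ℕ => ((n : ℝ))⁻¹) atTop (𝓝 0) :=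
    tendsto_inv_atTop_zero.comp tendsto_natCast_atTop_atTop
  -- The generating function diverges slightly below `N`.
  have hdiv : ∀ᶠ n : ℕ in atTop, 1 ≤ n ∧ ¬ Summable fun m : ℕ =>
      ((avoidingWords (prefixFamily x n) m).ncard : ℝ) * (N - ((n : ℝ) ^ 2)⁻¹)⁻¹ ^ m := by
    have hz : ∀ᶠ n : ℕ in atTop, 0 < (N : ℝ) - ((n : ℝ) ^ 2)⁻¹ := by
      filter_upwards [eventually_ge_atTop 1] with n hn
      have : ((n : ℝ) ^ 2)⁻¹ ≤ 1 := inv_le_one_of_one_le₀ (one_le_pow₀ (by exact_mod_cast hn))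
      linarith
    have hzN : Tendsto (fun n : ℕ => (n : ℝ) * ((N - ((n : ℝ) ^ 2)⁻¹) - N)) atTop (𝓝 0) := by
      rw [← neg_zero]
      refine hinv_nat.neg.congr' ?_
      filter_upwards [eventually_gt_atTop 0] with n hn
      have : (n : ℝ) ≠ 0 := by positivity
      field_simp
      ring
    obtain ⟨hunit, hlim⟩ := hs _ hz hzN
    have hsmall : Tendsto (fun n : ℕ => (n : ℝ) ^ 2 *
        ∑ i, ∑ j, (corrMatrix x n (N - ((n : ℝ) ^ 2)⁻¹))⁻¹ i j) atTop (𝓝 0) := by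
      have h := (tendsto_pow_const_div_const_pow_of_one_lt 2 hNone).mul hlim
      rw [zero_mul] at h
      refine h.congr fun n => ?_
      have := hpow n
      field_simp
    filter_upwards [hz, hunit, hsmall.eventually_lt_const one_pos, eventually_ge_atTop 1]
      with n hzn hun hsn hn
    refine ⟨hn, fun hsum => ?_⟩
    rw [hK] at hsum
    have h1 := card_sub_lt_sum_inv hn (hlen n) (hinj n hn) hzn hsum (hM n _) hun
    have hn2 : (0 : ℝ) < (n : ℝ) ^ 2 := by positivity
    rw [Fintype.card_fin, sub_sub_cancel, inv_lt_iff_one_lt_mul₀ hn2] at h1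
    linarith
  have hrate : ∀ n : ℕ, ∃ r : ℝ, (1 ≤ n ∧ ¬ Summable fun m : ℕ =>
      ((avoidingWords (prefixFamily x n) m).ncard : ℝ) * (N - ((n : ℝ) ^ 2)⁻¹)⁻¹ ^ m) →
      0 < r ∧ (∀ m, r ^ m ≤ (avoidingWords (prefixFamily x n) m).ncard) ∧
      Tendsto (fun m : ℕ => Real.log (avoidingWords (prefixFamily x n) m).ncard / m) atTop
        (𝓝 (Real.log r)) ∧
      ∀ z, r < z → Summable fun m : ℕ =>
        ((avoidingWords (prefixFamily x n) m).ncard : ℝ) * z⁻¹ ^ m := by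
    intro n
    by_cases hn : 1 ≤ n ∧ ¬ Summable fun m : ℕ =>
      ((avoidingWords (prefixFamily x n) m).ncard : ℝ) * (N - ((n : ℝ) ^ 2)⁻¹)⁻¹ ^ m
    · obtain ⟨r, hr⟩ := exists_growth_rate fun m h => hn.2 (summable_of_ncard_eq_zero h _)
      exact ⟨r, fun _ => hr⟩
    · exact ⟨0, fun h => absurd h hn⟩
  choose r hr using hrate
  have hr_ge : ∀ᶠ n : ℕ in atTop, N - ((n : ℝ) ^ 2)⁻¹ ≤ r n := by
    filter_upwards [hdiv] with n hn
    by_contra! hlt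
    exact hn.2 ((hr n hn).2.2.2 _ hlt)
  have hr_le : ∀ᶠ n : ℕ in atTop, r n ≤ N := by
    filter_upwards [hdiv] with n hn
    have h1 := (hr n hn).2.1 1
    rw [pow_one] at h1
    refine h1.trans ?_
    have h2 := Set.ncard_le_ncard (s := avoidingWords (prefixFamily x n) 1)
      (t := {v | v.length = 1}) (fun v hv => hv.1)
      (List.finite_length_eq (Fin N) 1)
    rw [ncard_length_eq, pow_one, Fintype.card_fin] at h2
    exact_mod_cast h2
  have hrN : Tendsto (fun n : ℕ => (n : ℝ) * (r n - N)) atTop (𝓝 0) := by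
    have h0 := hinv_nat.neg
    rw [neg_zero] at h0
    refine tendsto_of_tendsto_of_tendsto_of_le_of_le' h0 tendsto_const_nhds ?_ ?_
    · filter_upwards [hr_ge, eventually_gt_atTop 0] with n hn hn0
      have hn' : (0 : ℝ) < n := by exact_mod_cast hn0
      calc -(n : ℝ)⁻¹ = n * -((n : ℝ) ^ 2)⁻¹ := by field_simp
        _ ≤ n * (r n - N) := by gcongr; linarith
    · filter_upwards [hr_le] with n hn
      exact mul_nonpos_of_nonneg_of_nonpos n.cast_nonneg (by linarith)
  set ε : ℕ → ℝ := fun n => ((N : ℝ) ^ n)⁻¹ * (n + 1 : ℝ)⁻¹ with hε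
  have hεpos : ∀ n, 0 < ε n := fun n => by positivity
  have hεN : Tendsto (fun n => ε n * (N : ℝ) ^ n) atTop (𝓝 0) := by
    refine (tendsto_one_div_add_atTop_nhds_zero_nat (𝕜 := ℝ)).congr fun n => ?_
    have := hpow n
    simp only [hε]
    field_simp
  have hεn : Tendsto (fun n : ℕ => (n : ℝ) * ε n) atTop (𝓝 0) := by
    have h := tendsto_inv_atTop_zero.comp (tendsto_pow_atTop_atTop_of_one_lt hNone)
    refine squeeze_zero (fun n => by positivity) (fun n => ?_) h
    have h1 : (n : ℝ) * (n + 1 : ℝ)⁻¹ ≤ 1 := by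
      rw [← div_eq_mul_inv, div_le_one (by positivity)]; linarith
    calc (n : ℝ) * ε n = ((N : ℝ) ^ n)⁻¹ * (n * (n + 1 : ℝ)⁻¹) := by simp only [hε]; ring
      _ ≤ ((N : ℝ) ^ n)⁻¹ * 1 := by gcongr
      _ = _ := by simp
  obtain ⟨hunit, hlim⟩ := hs (fun n => r n + ε n)
    (by filter_upwards [hdiv] with n hn using add_pos (hr n hn).1 (hεpos n))
    (by simpa using (hrN.add hεn).congr fun n => by ring)
  have hdrop : Tendsto (fun n => (N - r n) * (N : ℝ) ^ n) atTop (𝓝 (∑ i, ∑ j, α⁻¹ i j)) := by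
    have hupp := hlim.add hεN
    rw [add_zero] at hupp
    refine tendsto_of_tendsto_of_tendsto_of_le_of_le' hlim hupp ?_ ?_
    · filter_upwards [hdiv, hunit] with n hn hun
      obtain ⟨hrpos, hrle, -, hsum⟩ := hr n hn
      have hsum' := hsum _ (lt_add_of_pos_right _ (hεpos n))
      rw [hK] at hrle hsum'
      have h1 := sum_inv_le_card_sub hn.1 (hlen n) (hinj n hn.1) hrpos
        (lt_add_of_pos_right _ (hεpos n)) hrle hsum' (hM n _) hun
      rw [Fintype.card_fin] at h1
      exact mul_le_mul_of_nonneg_right h1 (by positivity)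
    · filter_upwards [hdiv, hunit] with n hn hun
      obtain ⟨hrpos, -, -, hsum⟩ := hr n hn
      have hsum' := hsum _ (lt_add_of_pos_right _ (hεpos n))
      rw [hK] at hsum'
      have h1 := card_sub_lt_sum_inv hn.1 (hlen n) (hinj n hn.1) (add_pos hrpos (hεpos n))
        hsum' (hM n _) hun
      rw [Fintype.card_fin] at h1
      rw [← add_mul]
      exact mul_le_mul_of_nonneg_right (by linarith) (by positivity)
  have hr_tendsto : Tendsto r atTop (𝓝 N) := by
    have h0 : Tendsto (fun n : ℕ => (N : ℝ) - ((n : ℝ) ^ 2)⁻¹) atTop (𝓝 N) := by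
      have h := tendsto_const_nhds (x := (N : ℝ)).sub (hinv_nat.pow 2)
      simpa using h
    exact tendsto_of_tendsto_of_tendsto_of_le_of_le' h0 tendsto_const_nhds hr_ge hr_le
  refine (tendsto_log_sub_mul hNpos (fun n => by positivity) hr_tendsto hdrop).congr' ?_
  filter_upwards [hdiv] with n hn
  obtain ⟨hrpos, hrle, hrlim, -⟩ := hr n hn
  rw [entropy_univ, Fintype.card_fin, entropy_perturbFamily_eq_log hrpos hrle hrlim]
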